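/- For any density matrix ρ and any d×d unitary matrix U relating two orthonormal bases, with induced probability vectors p and q, one has H(p) + H(q) ≥ −ln(∑_{i,j} p_i q_j |U_{ij}|²) + S(ρ). -/

import Mathlib

open scoped BigOperators Matrix ComplexConjugate ComplexOrder

/-- Shannon entropy of a finite real vector (natural logarithm). -/
noncomputable def shannonEntropy {n : Type*} [Fintype n] (x : n → ℝ) : ℝ :=
  -∑ i, x i * Real.log (x i)

/-- Von Neumann entropy of a Hermitian matrix, `-∑ λᵢ ln λᵢ`. -/
noncomputable def vonNeumannEntropy {d : ℕ} {ρ : Matrix (Fin d) (Fin d) ℂ}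
    (hρ : ρ.IsHermitian) : ℝ :=
  -∑ i, hρ.eigenvalues i * Real.log (hρ.eigenvalues i)

/-- `∑ wᵢ xᵢ (log (yᵢ + t xᵢ) - log yᵢ)`, which interpolates between `0` at `t = 0` and, up to a
multiple of `log t`, a relative entropy as `t → ∞`. -/
noncomputable def logInterpolation {ι : Type*} [Fintype ι] (w x y : ι → ℝ) (t : ℝ) : ℝ :=
  ∑ i, w i * x i * (Real.log (y i + t * x i) - Real.log (y i))

theorem hasDerivAt_logInterpolation {ι : Type*} [Fintype ι] {w x y : ι → ℝ}
    (hx : ∀ i, 0 ≤ x i) (hy : ∀ i, w i * x i ≠ 0 → 0 < y i) {t : ℝ} (ht : 0 ≤ t) :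
    HasDerivAt (logInterpolation w x y) (∑ i, w i * (x i ^ 2 / (y i + t * x i))) t := by
  unfold logInterpolation
  refine HasDerivAt.fun_sum fun i _ => ?_
  by_cases h : w i * x i = 0
  · have h' : w i * (x i ^ 2 / (y i + t * x i)) = 0 := by
      rcases mul_eq_zero.1 h with h | h <;> simp [h]
    simpa [h, h'] using hasDerivAt_const t (0 : ℝ)
  · have hpos : 0 < y i + t * x i := add_pos_of_pos_of_nonneg (hy i h) (mul_nonneg ht (hx i))
    have h1 : HasDerivAt (fun s : ℝ => y i + s * x i) (x i) t := by
      simpa using ((hasDerivAt_id t).mul_const (x i)).const_add (y i)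
    exact (((h1.log hpos.ne').sub_const (Real.log (y i))).const_mul (w i * x i)).congr_deriv
      (by ring)

theorem tendsto_logInterpolation_sub_log {ι : Type*} [Fintype ι] {w x y : ι → ℝ}
    (hx : ∀ i, 0 ≤ x i) (hy : ∀ i, w i * x i ≠ 0 → 0 < y i) :
    Filter.Tendsto (fun t => logInterpolation w x y t - (∑ i, w i * x i) * Real.log t)
      Filter.atTop (nhds (∑ i, w i * x i * (Real.log (x i) - Real.log (y i)))) := by
  have key : Filter.Tendsto
      (fun t : ℝ => ∑ i, w i * x i * (Real.log (y i * t⁻¹ + x i) - Real.log (y i)))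
      Filter.atTop (nhds (∑ i, w i * x i * (Real.log (x i) - Real.log (y i)))) := by
    refine tendsto_finsetSum _ fun i _ => ?_
    by_cases h : w i * x i = 0
    · simp [h]
    · have hxi : x i ≠ 0 := right_ne_zero_of_mul h
      have h1 : Filter.Tendsto (fun t : ℝ => y i * t⁻¹ + x i) Filter.atTop (nhds (x i)) := by
        simpa using (tendsto_inv_atTop_zero.const_mul (y i)).add_const (x i)
      exact ((h1.log hxi).sub_const _).const_mul _
  refine key.congr' ?_
  filter_upwards [Filter.eventually_gt_atTop (0 : ℝ)] with t ht
  rw [logInterpolation, Finset.sum_mul, ← Finset.sum_sub_distrib]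
  refine Finset.sum_congr rfl fun i _ => ?_
  by_cases h : w i * x i = 0
  · simp [h]
  · have hpos : 0 < y i * t⁻¹ + x i :=
      add_pos_of_pos_of_nonneg (mul_pos (hy i h) (inv_pos.2 ht)) (hx i)
    have : y i + t * x i = (y i * t⁻¹ + x i) * t := by field_simp
    rw [this, Real.log_mul hpos.ne' ht.ne']
    ring

/-- An inequality between the resolvent sums of two families integrates to an inequality between
their relative entropies. -/
theorem sum_mul_log_sub_log_le_of_resolvent_le {ι κ : Type*} [Fintype ι] [Fintype κ]
    {w x y : ι → ℝ} {w' x' y' : κ → ℝ}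
    (hx : ∀ i, 0 ≤ x i) (hy : ∀ i, w i * x i ≠ 0 → 0 < y i)
    (hx' : ∀ i, 0 ≤ x' i) (hy' : ∀ i, w' i * x' i ≠ 0 → 0 < y' i)
    (hsum : ∑ i, w' i * x' i = ∑ i, w i * x i)
    (hle : ∀ t : ℝ, 0 < t →
      ∑ i, w' i * (x' i ^ 2 / (y' i + t * x' i)) ≤ ∑ i, w i * (x i ^ 2 / (y i + t * x i))) :
    ∑ i, w' i * x' i * (Real.log (x' i) - Real.log (y' i)) ≤
      ∑ i, w i * x i * (Real.log (x i) - Real.log (y i)) := by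
  have hd : ∀ t : ℝ, 0 ≤ t → HasDerivAt
      (fun t => logInterpolation w x y t - logInterpolation w' x' y' t) _ t := fun t ht =>
    (hasDerivAt_logInterpolation hx hy ht).sub (hasDerivAt_logInterpolation hx' hy' ht)
  have hmono : MonotoneOn (fun t => logInterpolation w x y t - logInterpolation w' x' y' t)
      (Set.Ici 0) := by
    refine monotoneOn_of_deriv_nonneg (convex_Ici 0)
      (fun t ht => (hd t ht).continuousAt.continuousWithinAt)
      (fun t ht => ?_) (fun t ht => ?_) <;> rw [interior_Ici] at ht
    · exact (hd t (le_of_lt ht)).differentiableAt.differentiableWithinAt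
    · rw [(hd t (le_of_lt ht)).deriv]
      exact sub_nonneg.2 (hle t ht)
  refine le_of_tendsto_of_tendsto (tendsto_logInterpolation_sub_log hx' hy')
    (tendsto_logInterpolation_sub_log hx hy) ?_
  filter_upwards [Filter.eventually_ge_atTop (0 : ℝ)] with t ht
  have := hmono (Set.mem_Ici.2 le_rfl) (Set.mem_Ici.2 ht) ht
  simp only [logInterpolation, zero_mul, add_zero, sub_self, mul_zero,
    Finset.sum_const_zero] at this
  simp only [hsum, logInterpolation]
  linarith

theorem two_mul_re_sub_le_norm_sq_mul_div {z m : ℂ} {x y : ℝ} (hy : 0 ≤ y)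
    (hxy : y = 0 → x = 0) :
    2 * (x * (star m * z).re) - ‖m‖ ^ 2 * y ≤ ‖z‖ ^ 2 * (x ^ 2 / y) := by
  rcases hy.eq_or_lt with h | h
  · simp [← h, hxy h.symm]
  · rw [← mul_div_assoc, le_div_iff₀ h, ← Complex.normSq_eq_norm_sq, ← Complex.normSq_eq_norm_sq,
      Complex.normSq_apply, Complex.normSq_apply]
    simp only [Complex.star_def, Complex.mul_re, Complex.conj_re, Complex.conj_im]
    nlinarith [sq_nonneg (z.re * x - m.re * y), sq_nonneg (z.im * x - m.im * y)]

/-- Jensen's inequality for the logarithm, allowing vanishing weights. -/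
theorem sum_mul_log_le_log_sum_mul {ι : Type*} [Fintype ι] {q r : ι → ℝ}
    (hq : ∀ i, 0 ≤ q i) (hr : ∀ i, q i ≠ 0 → 0 < r i) (hsum : ∑ i, q i = 1) :
    ∑ i, q i * Real.log (r i) ≤ Real.log (∑ i, q i * r i) := by
  have hnn : ∀ i ∈ Finset.univ, 0 ≤ q i * r i := fun i _ => by
    by_cases h : q i = 0
    · simp [h]
    · exact mul_nonneg (hq i) (hr i h).le
  obtain ⟨j, -, hj⟩ := Finset.exists_ne_zero_of_sum_ne_zero (hsum ▸ one_ne_zero)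
  have hZ : 0 < ∑ i, q i * r i :=
    Finset.sum_pos' hnn ⟨j, Finset.mem_univ j, mul_pos ((hq j).lt_of_ne' hj) (hr j hj)⟩
  set Z := ∑ i, q i * r i with hZdef
  have hterm : ∀ i ∈ Finset.univ, q i * Real.log (r i) ≤ q i * Real.log Z +
      (q i * r i / Z - q i) := fun i _ => by
    by_cases h : q i = 0
    · simp [h]
    · have := Real.log_le_sub_one_of_pos (div_pos (hr i h) hZ)
      rw [Real.log_div (hr i h).ne' hZ.ne'] at this
      have := mul_le_mul_of_nonneg_left this (hq i)
      rw [mul_div_assoc]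
      linarith
  refine (Finset.sum_le_sum hterm).trans_eq ?_
  rw [Finset.sum_add_distrib, Finset.sum_sub_distrib, ← Finset.sum_mul, ← Finset.sum_div, hsum,
    ← hZdef, div_self hZ.ne']
  ring

section Matrix

variable {n : Type*} [Fintype n] [DecidableEq n]

theorem re_mul_diagonal_mul_conjTranspose_apply (M : Matrix n n ℂ) (f : n → ℝ) (i : n) :
    ((M * Matrix.diagonal (fun a => (f a : ℂ)) * Mᴴ) i i).re = ∑ a, ‖M i a‖ ^ 2 * f a := by
  rw [Matrix.mul_apply, Complex.re_sum]
  refine Finset.sum_congr rfl fun a _ => ?_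
  rw [Matrix.mul_diagonal, Matrix.conjTranspose_apply, ← Complex.normSq_eq_norm_sq,
    Complex.normSq_apply]
  simp
  ring

theorem re_trace_diagonal_mul (A : Matrix n n ℂ) (c : n → ℝ) :
    (Matrix.diagonal (fun a => (c a : ℂ)) * A).trace.re = ∑ j, c j * (A j j).re := by
  simp [Matrix.trace, Matrix.diagonal_mul, Complex.re_sum]

theorem re_trace_diagonal_mul_mul_diagonal (A : Matrix n n ℂ) (c : n → ℝ) :
    (Matrix.diagonal (fun a => (c a : ℂ)) * A * Matrix.diagonal (fun a => (c a : ℂ))).trace.re =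
      ∑ j, c j ^ 2 * (A j j).re := by
  simp only [Matrix.trace, Matrix.diag, Matrix.mul_diagonal, Matrix.diagonal_mul, Complex.re_sum]
  refine Finset.sum_congr rfl fun j _ => ?_
  simp
  ring

/-- The resolvent form of the monotonicity of relative entropy under the measurement in the basis
given by the columns of `U`. -/
theorem sum_sq_div_le_sum_sq_div_of_unitary {U V : Matrix n n ℂ}
    (hU : U ∈ Matrix.unitaryGroup n ℂ) (hV : V ∈ Matrix.unitaryGroup n ℂ) {l p : n → ℝ}
    (hl : ∀ a, 0 ≤ l a) (hp : ∀ k, 0 ≤ p k) {q r : n → ℝ}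
    (hq : ∀ j, q j = ((Uᴴ * (V * Matrix.diagonal (fun a => (l a : ℂ)) * Vᴴ) * U) j j).re)
    (hr : ∀ j, r j = ((Uᴴ * Matrix.diagonal (fun a => (p a : ℂ)) * U) j j).re)
    {t : ℝ} (ht : 0 < t) :
    ∑ j, q j ^ 2 / (r j + t * q j) ≤ ∑ k, ∑ a, ‖V k a‖ ^ 2 * (l a ^ 2 / (p k + t * l a)) := by
  have hUU : Uᴴ * U = 1 := Matrix.mem_unitaryGroup_iff'.1 hU
  have hVV : V * Vᴴ = 1 := Matrix.mem_unitaryGroup_iff.1 hV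
  set c : n → ℝ := fun j => q j / (r j + t * q j) with hc
  set D : Matrix n n ℂ := Matrix.diagonal (fun a => (c a : ℂ)) with hD
  set L : Matrix n n ℂ := Matrix.diagonal (fun a => (l a : ℂ)) with hL
  set P : Matrix n n ℂ := Matrix.diagonal (fun a => (p a : ℂ)) with hP
  set M : Matrix n n ℂ := U * D * Uᴴ * V with hM
  have hDs : Dᴴ = D := by
    rw [hD, Matrix.diagonal_conjTranspose]
    congr 1
    ext a
    simp
  have hMs : Mᴴ = Vᴴ * U * D * Uᴴ := by
    simp only [hM, Matrix.conjTranspose_mul, Matrix.conjTranspose_conjTranspose, hDs,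
      Matrix.mul_assoc]
  have h1 : ∑ k, ∑ a, ‖M k a‖ ^ 2 * l a = ∑ j, c j ^ 2 * q j := by
    simp only [hq]
    rw [← re_trace_diagonal_mul_mul_diagonal, ← hD]
    simp only [← re_mul_diagonal_mul_conjTranspose_apply, ← Complex.re_sum, ← hL]
    change (M * L * Mᴴ).trace.re = _
    have e : M * L * Mᴴ = U * (D * (Uᴴ * (V * L * Vᴴ) * U) * D * Uᴴ) := by
      rw [hMs, hM]
      simp only [Matrix.mul_assoc]
    rw [e, Matrix.trace_mul_comm, Matrix.mul_assoc _ Uᴴ U, hUU, Matrix.mul_one]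
  have h2 : ∑ k, ∑ a, ‖M k a‖ ^ 2 * p k = ∑ j, c j ^ 2 * r j := by
    simp only [hr]
    rw [← re_trace_diagonal_mul_mul_diagonal, ← hD, Finset.sum_comm]
    have e' : ∀ a, ∑ k, ‖M k a‖ ^ 2 * p k = ((Mᴴ * P * Mᴴᴴ) a a).re := fun a => by
      rw [hP, re_mul_diagonal_mul_conjTranspose_apply]
      simp [Matrix.conjTranspose_apply]
    simp only [e', ← Complex.re_sum]
    change (Mᴴ * P * Mᴴᴴ).trace.re = _
    have e : Mᴴ * P * Mᴴᴴ = Vᴴ * (U * (D * (Uᴴ * P * U) * D * Uᴴ)) * V := by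
      rw [Matrix.conjTranspose_conjTranspose, hMs, hM]
      simp only [Matrix.mul_assoc]
    rw [e, Matrix.trace_mul_comm, ← Matrix.mul_assoc, hVV, Matrix.one_mul,
      Matrix.trace_mul_comm, Matrix.mul_assoc _ Uᴴ U, hUU, Matrix.mul_one]
  have h3 : ∑ k, ∑ a, l a * (star (M k a) * V k a).re = ∑ j, c j * q j := by
    simp only [hq]
    rw [← re_trace_diagonal_mul, ← hD, Finset.sum_comm]
    have e' : ∀ a, ∑ k, l a * (star (M k a) * V k a).re = ((L * (Mᴴ * V)) a a).re := fun a => by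
      rw [hL, Matrix.diagonal_mul, Complex.re_ofReal_mul, Matrix.mul_apply, Complex.re_sum,
        Finset.mul_sum]
      rfl
    simp only [e', ← Complex.re_sum]
    change (L * (Mᴴ * V)).trace.re = _
    rw [hMs, ← Matrix.mul_assoc, Matrix.trace_mul_comm]
    have e : V * (L * (Vᴴ * U * D * Uᴴ)) = (V * L * Vᴴ) * U * (D * Uᴴ) := by
      simp only [Matrix.mul_assoc]
    rw [e, Matrix.trace_mul_comm]
    simp only [Matrix.mul_assoc]
  have hleft : ∑ j, q j ^ 2 / (r j + t * q j) =
      2 * ∑ j, c j * q j - (∑ j, c j ^ 2 * r j + t * ∑ j, c j ^ 2 * q j) := by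
    rw [Finset.mul_sum, Finset.mul_sum, ← Finset.sum_add_distrib, ← Finset.sum_sub_distrib]
    refine Finset.sum_congr rfl fun j _ => ?_
    by_cases h : r j + t * q j = 0
    · simp [hc, h]
    · simp only [hc]
      field_simp
      ring
  rw [hleft, ← h1, ← h2, ← h3]
  simp only [Finset.mul_sum, ← Finset.sum_add_distrib, ← Finset.sum_sub_distrib]
  refine Finset.sum_le_sum fun k _ => Finset.sum_le_sum fun a _ => ?_
  refine le_trans (le_of_eq ?_) (two_mul_re_sub_le_norm_sq_mul_div (z := V k a) (m := M k a)
    (x := l a) (y := p k + t * l a) (add_nonneg (hp k) (mul_nonneg ht.le (hl a))) fun h => ?_)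
  · ring
  · nlinarith [hp k, hl a, mul_nonneg ht.le (hl a), mul_pos ht ht]

end Matrix

theorem stmt_3 (d : ℕ) (hd : 2 ≤ d)
    (U : Matrix (Fin d) (Fin d) ℂ) (hU : U ∈ Matrix.unitaryGroup (Fin d) ℂ)
    (ρ : Matrix (Fin d) (Fin d) ℂ) (hρ : ρ.PosSemidef) (hρtr : ρ.trace = 1)
    (p q : Fin d → ℝ)
    (hp : ∀ i, p i = (ρ i i).re)
    (hq : ∀ j, q j = ((Uᴴ * ρ * U) j j).re) :
    shannonEntropy p + shannonEntropy q ≥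
      -Real.log (∑ i, ∑ j, p i * q j * ‖U i j‖ ^ 2) +
        vonNeumannEntropy hρ.isHermitian := by
  have hUU : U * Uᴴ = 1 := Matrix.mem_unitaryGroup_iff.1 hU
  set l := hρ.isHermitian.eigenvalues with hldef
  set V : Matrix (Fin d) (Fin d) ℂ := hρ.isHermitian.eigenvectorUnitary.1
  have hV : V ∈ Matrix.unitaryGroup (Fin d) ℂ := hρ.isHermitian.eigenvectorUnitary.2
  have hl : ∀ a, 0 ≤ l a := hρ.eigenvalues_nonneg
  have hspec : ρ = V * Matrix.diagonal (fun a => (l a : ℂ)) * Vᴴ :=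
    hρ.isHermitian.spectral_theorem
  set r : Fin d → ℝ := fun j => ((Uᴴ * Matrix.diagonal (fun a => (p a : ℂ)) * U) j j).re
  have hpsum : ∀ k, p k = ∑ a, ‖V k a‖ ^ 2 * l a := fun k => by
    rw [hp, ← re_mul_diagonal_mul_conjTranspose_apply, ← hspec]
  have hqsum : ∀ j, q j = ∑ a, ‖(Uᴴ * V) j a‖ ^ 2 * l a := fun j => by
    rw [hq, ← re_mul_diagonal_mul_conjTranspose_apply, hspec]
    simp only [Matrix.conjTranspose_mul, Matrix.conjTranspose_conjTranspose, Matrix.mul_assoc]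
  have hrsum : ∀ j, r j = ∑ i, p i * ‖U i j‖ ^ 2 := fun j => by
    have e := re_mul_diagonal_mul_conjTranspose_apply Uᴴ p j
    rw [Matrix.conjTranspose_conjTranspose] at e
    refine e.trans ?_
    simp [Matrix.conjTranspose_apply, mul_comm]
  have hp0 : ∀ k, 0 ≤ p k := fun k => by
    rw [hpsum]
    exact Finset.sum_nonneg fun a _ => mul_nonneg (sq_nonneg _) (hl a)
  have hq0 : ∀ j, 0 ≤ q j := fun j => by
    rw [hqsum]
    exact Finset.sum_nonneg fun a _ => mul_nonneg (sq_nonneg _) (hl a)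
  have hp1 : ∑ k, p k = 1 := by
    simp only [hp, ← Complex.re_sum]
    exact congrArg Complex.re hρtr
  have hq1 : ∑ j, q j = 1 := by
    simp only [hq, ← Complex.re_sum]
    have : (Uᴴ * ρ * U).trace = 1 := by
      rw [Matrix.trace_mul_comm, ← Matrix.mul_assoc, hUU, Matrix.one_mul, hρtr]
    exact congrArg Complex.re this
  have hppos : ∀ k a, ‖V k a‖ ^ 2 * l a ≠ 0 → 0 < p k := fun k a h => by
    rw [hpsum]
    have h0 : ∀ a ∈ Finset.univ, 0 ≤ ‖V k a‖ ^ 2 * l a :=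
      fun a _ => mul_nonneg (sq_nonneg _) (hl a)
    exact Finset.sum_pos' h0
      ⟨a, Finset.mem_univ a, (h0 a (Finset.mem_univ a)).lt_of_ne' h⟩
  have hrpos : ∀ j, q j ≠ 0 → 0 < r j := fun j h => by
    rw [hqsum] at h
    obtain ⟨a, -, ha⟩ := Finset.exists_ne_zero_of_sum_ne_zero h
    have hla : l a ≠ 0 := right_ne_zero_of_mul ha
    have hW : (Uᴴ * V) j a ≠ 0 := fun h0 => ha (by simp [h0])
    rw [Matrix.mul_apply] at hW
    obtain ⟨k, -, hk⟩ := Finset.exists_ne_zero_of_sum_ne_zero hW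
    have hVk : V k a ≠ 0 := right_ne_zero_of_mul hk
    have hUk : U k j ≠ 0 := fun h0 => hk (by simp [Matrix.conjTranspose_apply, h0])
    have hpk : 0 < p k := hppos k a (mul_ne_zero (pow_ne_zero 2 (norm_ne_zero_iff.2 hVk)) hla)
    rw [hrsum]
    exact Finset.sum_pos' (fun i _ => mul_nonneg (hp0 i) (sq_nonneg _))
      ⟨k, Finset.mem_univ k, mul_pos hpk (pow_pos (norm_pos_iff.2 hUk) 2)⟩
  have hVcol : ∀ a, ∑ k, ‖V k a‖ ^ 2 = 1 := fun a => by
    have e := re_mul_diagonal_mul_conjTranspose_apply Vᴴ (fun _ => 1) a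
    have hVV : Vᴴ * V = 1 := Matrix.mem_unitaryGroup_iff'.1 hV
    simpa [Matrix.conjTranspose_apply, hVV] using e.symm
  have hmono := sum_mul_log_sub_log_le_of_resolvent_le
    (w := fun z : Fin d × Fin d => ‖V z.1 z.2‖ ^ 2) (x := fun z => l z.2) (y := fun z => p z.1)
    (w' := fun _ : Fin d => 1) (x' := q) (y' := r)
    (fun z => hl z.2) (fun z => hppos z.1 z.2) hq0 (fun j h => hrpos j (by simpa using h))
    (by
      rw [Fintype.sum_prod_type]
      simp only [one_mul, ← hpsum, hp1, hq1])
    (fun t ht => by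
      rw [Fintype.sum_prod_type]
      simp only [one_mul]
      exact sum_sq_div_le_sum_sq_div_of_unitary hU hV hl hp0 (fun j => by rw [hq, ← hspec])
        (fun _ => rfl) ht)
  have hright : ∑ z : Fin d × Fin d, ‖V z.1 z.2‖ ^ 2 * l z.2 *
      (Real.log (l z.2) - Real.log (p z.1)) =
      ∑ a, l a * Real.log (l a) - ∑ k, p k * Real.log (p k) := by
    simp only [mul_sub, Finset.sum_sub_distrib]
    congr 1
    · rw [Fintype.sum_prod_type_right]
      refine Finset.sum_congr rfl fun a _ => ?_
      simp only [mul_assoc]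
      rw [← Finset.sum_mul, hVcol, one_mul]
    · rw [Fintype.sum_prod_type]
      refine Finset.sum_congr rfl fun k _ => ?_
      simp only [← Finset.sum_mul, ← hpsum]
  rw [hright] at hmono
  simp only [one_mul, mul_sub, Finset.sum_sub_distrib] at hmono
  have hjensen := sum_mul_log_le_log_sum_mul hq0 hrpos hq1
  have hoverlap : ∑ i, ∑ j, p i * q j * ‖U i j‖ ^ 2 = ∑ j, q j * r j := by
    rw [Finset.sum_comm]
    refine Finset.sum_congr rfl fun j _ => ?_
    rw [hrsum, Finset.mul_sum]
    exact Finset.sum_congr rfl fun i _ => by ring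
  rw [hoverlap]
  simp only [shannonEntropy, vonNeumannEntropy, ← hldef]
  linarith
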